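/- Let φ : ℝ → GL(n, ℂ) be a continuous group homomorphism (from the additive group ℝ) that is nontrivial (not constantly the identity) and not injective. Then there exists a continuous injective group homomorphism γ : S¹ → GL(n, ℂ) from the circle group whose range equals the range of φ. -/

import Mathlib

open Real in
/-- A nontrivial, non-injective continuous homomorphism from `ℝ` to a `T1` group, after a linear
change of parameter, has the same fibres as `Circle.exp`. -/
theorem exists_rescale_eq_iff_circleExp_eq {G : Type*} [Group G] [TopologicalSpace G] [T1Space G]
    {φ : ℝ → G} (hcont : Continuous φ) (hhom : ∀ s t : ℝ, φ (s + t) = φ s * φ t)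
    (hnt : ∃ t : ℝ, φ t ≠ 1) (hni : ¬ Function.Injective φ) :
    ∃ c : ℝ, c ≠ 0 ∧ ∀ s t : ℝ, φ (c * s) = φ (c * t) ↔ Circle.exp s = Circle.exp t := by
  let f : ℝ →+ Additive G := AddMonoidHom.mk' (fun t => Additive.ofMul (φ t)) hhom
  have hmem (t : ℝ) : t ∈ f.ker ↔ φ t = 1 := Iff.rfl
  have hclosed : IsClosed (f.ker : Set ℝ) := isClosed_singleton.preimage hcont
  have hndense : ¬ Dense (f.ker : Set ℝ) := by
    intro hd
    obtain ⟨t, ht⟩ := hnt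
    have huniv := hclosed.closure_eq ▸ hd.closure_eq
    exact ht ((hmem t).1 (huniv.symm ▸ Set.mem_univ t : t ∈ (f.ker : Set ℝ)))
  obtain ⟨a, ha⟩ := f.ker.dense_or_cyclic.resolve_left hndense
  have ha0 : a ≠ 0 := by
    rintro rfl
    refine hni ((injective_iff_map_eq_zero f).2 fun t ht => ?_)
    have : t ∈ f.ker := ht
    rw [ha, AddSubgroup.mem_closure_singleton] at this
    simpa [eq_comm] using this
  refine ⟨a / (2 * π), by positivity, fun s t => ?_⟩
  rw [Circle.exp_eq_exp]
  have h1 : φ (a / (2 * π) * s) = φ (a / (2 * π) * t) ↔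
      a / (2 * π) * s - a / (2 * π) * t ∈ f.ker := by
    rw [AddMonoidHom.mem_ker, map_sub, sub_eq_zero]
    rfl
  rw [h1, ha, AddSubgroup.mem_closure_singleton]
  refine exists_congr fun m => ?_
  rw [zsmul_eq_mul]
  constructor <;> intro h
  · field_simp at h
    linarith
  · rw [h]
    field_simp
    ring

/-- A nontrivial non-injective one-parameter subgroup of `GL(n, ℂ)` gives rise to a
knotted subgroup: a continuous injective homomorphism from the circle with the same range. -/
theorem knotted_of_oneParameterSubgroup (n : ℕ) (φ : ℝ → Matrix.GeneralLinearGroup (Fin n) ℂ)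
    (hcont : Continuous φ) (hhom : ∀ s t : ℝ, φ (s + t) = φ s * φ t)
    (hnt : ∃ t : ℝ, φ t ≠ 1) (hni : ¬ Function.Injective φ) :
    ∃ γ : Circle → Matrix.GeneralLinearGroup (Fin n) ℂ,
      Continuous γ ∧ Function.Injective γ ∧
      (∀ z w : Circle, γ (z * w) = γ z * γ w) ∧ Set.range γ = Set.range φ := by
  obtain ⟨c, hc, hiff⟩ := exists_rescale_eq_iff_circleExp_eq hcont hhom hnt hni
  have hq : Topology.IsQuotientMap Circle.exp := 
    isLocalHomeomorph_circleExp.isOpenMap.isQuotientMap Circle.exp.continuous Circle.exp_surjective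
  obtain ⟨e, he⟩ := hq.surjective.hasRightInverse
  have hγ (t : ℝ) : φ (c * e (Circle.exp t)) = φ (c * t) := (hiff _ _).2 (he _)
  refine ⟨fun z => φ (c * e z), ?_, ?_, ?_, ?_⟩
  · rw [hq.continuous_iff]
    exact (hcont.comp (continuous_const_mul c)).congr fun t => (hγ t).symm
  · intro z w h
    rw [← he z, ← he w]
    exact (hiff _ _).1 h
  · intro z w
    rw [← hhom, ← mul_add, hiff, Circle.exp_add, he, he, he]
  · refine Set.Subset.antisymm (Set.range_subset_iff.2 fun z => Set.mem_range_self _) ?_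
    rintro _ ⟨t, rfl⟩
    refine ⟨Circle.exp (t / c), ?_⟩
    simp only [hγ, mul_div_cancel₀ t hc]
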